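/- Let n ≥ 2, k algebraically closed of characteristic 0, Q a primitive n-th root of unity, and B(Q) as above. Then B(Q) ≅ ⊕_{q : q^n = Q} End_k(V_q) as k-algebras; in particular B(Q) is semisimple of dimension n³ with exactly n pairwise non-isomorphic irreducible modules, each of dimension n. -/

import Mathlib

open Finset

/-- The idempotent 𝟏ₛ of k[⟨a⟩], as a polynomial in the generator a = ι 0
    of the free algebra on three generators a, ξ, η. -/
noncomputable def oneF (k : Type*) [Field k] (n : ℕ) (Q : k) (s : ZMod n) :
    FreeAlgebra k (Fin 3) :=
  ((n : k))⁻¹ • ∑ j ∈ range n, (Q ^ (s.val * j))⁻¹ • FreeAlgebra.ι k 0 ^ j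

/-- The element E_r = Σ_{m=0}^{n-2} 𝟏_{m-r} + Q·𝟏_{n-1-r}, as a polynomial
    in a = ι 0. -/
noncomputable def EF (k : Type*) [Field k] (n : ℕ) (Q : k) (r : ZMod n) :
    FreeAlgebra k (Fin 3) :=
  (∑ m ∈ range (n - 1), oneF k n Q ((m : ZMod n) - r)) +
    Q • oneF k n Q (((n : ZMod n) - 1) - r)

/-- The defining relations of the algebra B(Q): aⁿ = ξⁿ = ηⁿ = 1,
    ξa = Q·aξ, ηa = Q·aη, and E₀·ξη = E₋₁·ηξ (equivalent to
    ξη = E₀⁻¹E₋₁·ηξ since E₀ is invertible). Here a = ι 0, ξ = ι 1, η = ι 2. -/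
inductive BRel (k : Type*) [Field k] (n : ℕ) (Q : k) :
    FreeAlgebra k (Fin 3) → FreeAlgebra k (Fin 3) → Prop
  | apow : BRel k n Q (FreeAlgebra.ι k 0 ^ n) 1
  | xipow : BRel k n Q (FreeAlgebra.ι k 1 ^ n) 1
  | etapow : BRel k n Q (FreeAlgebra.ι k 2 ^ n) 1
  | xia : BRel k n Q (FreeAlgebra.ι k 1 * FreeAlgebra.ι k 0)
      (Q • (FreeAlgebra.ι k 0 * FreeAlgebra.ι k 1))
  | etaa : BRel k n Q (FreeAlgebra.ι k 2 * FreeAlgebra.ι k 0)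
      (Q • (FreeAlgebra.ι k 0 * FreeAlgebra.ι k 2))
  | xieta : BRel k n Q
      (EF k n Q 0 * (FreeAlgebra.ι k 1 * FreeAlgebra.ι k 2))
      (EF k n Q (-1) * (FreeAlgebra.ι k 2 * FreeAlgebra.ι k 1))

/-- The algebra B(Q). -/
def BAlgebra (k : Type*) [Field k] (n : ℕ) (Q : k) : Type _ :=
  RingQuot (BRel k n Q)

noncomputable instance (k : Type*) [Field k] (n : ℕ) (Q : k) :
    Ring (BAlgebra k n Q) := by unfold BAlgebra; infer_instance

noncomputable instance (k : Type*) [Field k] (n : ℕ) (Q : k) :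
    Algebra k (BAlgebra k n Q) := by unfold BAlgebra; infer_instance

/-- The generator a of B(Q). -/
noncomputable def Ba (k : Type*) [Field k] (n : ℕ) (Q : k) : BAlgebra k n Q :=
  RingQuot.mkAlgHom k (BRel k n Q) (FreeAlgebra.ι k 0)

/-- The generator ξ of B(Q). -/
noncomputable def Bxi (k : Type*) [Field k] (n : ℕ) (Q : k) : BAlgebra k n Q :=
  RingQuot.mkAlgHom k (BRel k n Q) (FreeAlgebra.ι k 1)

/-- The generator η of B(Q). -/
noncomputable def Beta (k : Type*) [Field k] (n : ℕ) (Q : k) : BAlgebra k n Q :=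
  RingQuot.mkAlgHom k (BRel k n Q) (FreeAlgebra.ι k 2)

section Reindex

theorem prod_zmod_eq_prod_range {M : Type*} [CommMonoid M] (n : ℕ) [NeZero n] (f : ZMod n → M) :
    ∏ s, f s = ∏ m ∈ range n, f m := by
  refine Finset.prod_nbij' (fun s => s.val) (fun m => (m : ZMod n)) ?_ ?_ ?_ ?_ ?_
  · intro s _
    exact mem_range.2 (ZMod.val_lt s)
  · intro m _
    exact mem_univ _
  · intro s _
    exact ZMod.natCast_zmod_val s
  · intro m hm
    exact ZMod.val_cast_of_lt (mem_range.1 hm)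
  · intro s _
    rw [ZMod.natCast_zmod_val]

theorem sum_zmod_eq_sum_range {M : Type*} [AddCommMonoid M] (n : ℕ) [NeZero n] (f : ZMod n → M) :
    ∑ s, f s = ∑ m ∈ range n, f m :=
  prod_zmod_eq_prod_range (M := Multiplicative M) n f

theorem prod_range_add_natCast {M : Type*} [CommMonoid M] (n : ℕ) [NeZero n] (f : ZMod n → M)
    (s : ZMod n) : ∏ m ∈ range n, f (s + m) = ∏ t, f t := by
  rw [← prod_zmod_eq_prod_range n fun t => f (s + t)]
  exact Equiv.prod_comp (Equiv.addLeft s) f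

end Reindex

section Characters

variable {k : Type*} [Field k] {n : ℕ} [NeZero n] {Q : k}

theorem pow_val_add_one (hQ : Q ^ n = 1) (s : ZMod n) : Q ^ (s + 1).val = Q * Q ^ s.val := by
  rw [← pow_succ', pow_eq_pow_mod (s.val + 1) hQ, ZMod.val_add, ZMod.val_one_eq_one_mod,
    Nat.add_mod_mod]

theorem sum_range_character [CharZero k] (hQ : IsPrimitiveRoot Q n) (s t : ZMod n) :
    (n : k)⁻¹ * ∑ j ∈ range n, (Q ^ (t.val * j))⁻¹ * Q ^ (s.val * j) = if s = t then 1 else 0 := by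
  have hn : (n : k) ≠ 0 := Nat.cast_ne_zero.2 (NeZero.ne n)
  have hQ0 : Q ≠ 0 := hQ.ne_zero (NeZero.ne n)
  have key : ∀ j, (Q ^ (t.val * j))⁻¹ * Q ^ (s.val * j) = ((Q ^ t.val)⁻¹ * Q ^ s.val) ^ j := by
    intro j
    rw [mul_pow, inv_pow, pow_mul, pow_mul]
  simp_rw [key]
  split_ifs with h
  · subst h
    simp [inv_mul_cancel₀ (pow_ne_zero _ hQ0), hn]
  · have hr : (Q ^ t.val)⁻¹ * Q ^ s.val ≠ 1 := by
      intro hr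
      rw [inv_mul_eq_one₀ (pow_ne_zero _ hQ0)] at hr
      exact h (ZMod.val_injective n (hQ.pow_inj (ZMod.val_lt t) (ZMod.val_lt s) hr)).symm
    have hrn : ((Q ^ t.val)⁻¹ * Q ^ s.val) ^ n = 1 := by
      rw [mul_pow, inv_pow, ← pow_mul', ← pow_mul', pow_mul, pow_mul, hQ.pow_eq_one, one_pow,
        one_pow, inv_one, one_mul]
    rw [geom_sum_eq hr, hrn, sub_self, zero_div, mul_zero]

theorem sum_inv_character [CharZero k] (hQ : IsPrimitiveRoot Q n) {j : ℕ} (hj : j < n) :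
    (n : k)⁻¹ * ∑ s : ZMod n, (Q ^ (s.val * j))⁻¹ = if j = 0 then 1 else 0 := by
  have h := sum_range_character hQ 0 (j : ZMod n)
  have hval : ∑ s : ZMod n, (Q ^ (s.val * j))⁻¹ = ∑ m ∈ range n, (Q ^ (m * j))⁻¹ := by
    rw [sum_zmod_eq_sum_range]
    exact sum_congr rfl fun m hm => by rw [ZMod.val_cast_of_lt (mem_range.1 hm)]
  have hz : (0 : ZMod n) = j ↔ j = 0 := by
    rw [eq_comm, ZMod.natCast_eq_zero_iff]
    exact ⟨fun hd => Nat.eq_zero_of_dvd_of_lt hd hj, fun hd => hd ▸ dvd_zero n⟩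
  rw [hval, ← if_congr hz rfl rfl, ← h, ZMod.val_cast_of_lt hj]
  simp [mul_comm]

end Characters

section Diagonal

variable {k : Type*} [Field k] {n : ℕ} {Q : k} {R S : Type*} [Ring R] [Algebra k R]
  [Ring S] [Algebra k S]

/-- The element `𝟏ₛ` evaluated at `a`. -/
noncomputable def charIdem (Q : k) (a : R) (s : ZMod n) : R :=
  (n : k)⁻¹ • ∑ j ∈ range n, (Q ^ (s.val * j))⁻¹ • a ^ j

theorem map_charIdem (F : R →ₐ[k] S) (a : R) (s : ZMod n) :
    F (charIdem Q a s) = charIdem Q (F a) s := by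
  simp [charIdem, map_sum]

variable [NeZero n]

/-- The element acting by the scalar `f s` on the `Q ^ s`-eigenspace of `a`. -/
noncomputable def diagElt (Q : k) (a : R) (f : ZMod n → k) : R :=
  ∑ s, f s • charIdem Q a s

theorem map_diagElt (F : R →ₐ[k] S) (a : R) (f : ZMod n → k) :
    F (diagElt Q a f) = diagElt Q (F a) f := by
  simp [diagElt, map_sum, map_charIdem]

theorem diagElt_smul (a : R) (c : k) (f : ZMod n → k) :
    diagElt Q a (c • f) = c • diagElt Q a f := by
  simp [diagElt, smul_sum, mul_smul]

theorem diagElt_single (a : R) (s : ZMod n) : diagElt Q a (Pi.single s 1) = charIdem Q a s := by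
  simp [diagElt, Pi.single_apply]

theorem mul_charIdem (hQ : IsPrimitiveRoot Q n) {a : R} (ha : a ^ n = 1) (s : ZMod n) :
    a * charIdem Q a s = Q ^ s.val • charIdem Q a s := by
  have hQ0 : Q ≠ 0 := hQ.ne_zero (NeZero.ne n)
  rw [charIdem, mul_smul_comm, smul_comm (Q ^ s.val), mul_sum]
  have key : ∀ j, a * ((Q ^ (s.val * j))⁻¹ • a ^ j) =
      Q ^ s.val • ((Q ^ (s.val * (j + 1)))⁻¹ • a ^ (j + 1)) := by
    intro j
    rw [mul_smul_comm, smul_smul, ← pow_succ', mul_add, mul_one, pow_add Q, mul_inv,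
      mul_left_comm, mul_inv_cancel₀ (pow_ne_zero _ hQ0), mul_one]
  simp_rw [key, ← smul_sum]
  congr 1
  have h1 := sum_range_succ (fun j => (Q ^ (s.val * j))⁻¹ • a ^ j) n
  rw [sum_range_succ'] at h1
  have h2 : Q ^ (s.val * n) = 1 := by rw [mul_comm, pow_mul, hQ.pow_eq_one, one_pow]
  rw [h2, ha, mul_zero, pow_zero, pow_zero, add_left_inj] at h1
  rw [h1]

variable [CharZero k]

theorem charIdem_mul_charIdem (hQ : IsPrimitiveRoot Q n) {a : R} (ha : a ^ n = 1)
    (t s : ZMod n) :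
    charIdem Q a t * charIdem Q a s = if s = t then charIdem Q a s else 0 := by
  have hpow : ∀ j, a ^ j * charIdem Q a s = Q ^ (s.val * j) • charIdem Q a s := by
    intro j
    induction j with
    | zero => simp
    | succ j ih =>
      rw [pow_succ', mul_assoc, ih, mul_smul_comm, mul_charIdem hQ ha, smul_smul, ← pow_add,
        mul_add, mul_one]
  have h := sum_range_character hQ s t
  rw [charIdem, smul_mul_assoc, sum_mul]
  simp_rw [smul_mul_assoc, hpow, smul_smul, ← sum_smul, smul_smul, h]
  simp

theorem diagElt_one (hQ : IsPrimitiveRoot Q n) (a : R) :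
    diagElt Q a (1 : ZMod n → k) = 1 := by
  simp only [diagElt, charIdem, Pi.one_apply, one_smul]
  rw [← smul_sum, sum_comm]
  simp_rw [← sum_smul]
  rw [smul_sum]
  simp_rw [smul_smul]
  rw [sum_congr rfl fun j hj => by rw [sum_inv_character hQ (mem_range.1 hj)]]
  simp [NeZero.ne n, ite_smul]

theorem diagElt_mul (hQ : IsPrimitiveRoot Q n) {a : R} (ha : a ^ n = 1) (f g : ZMod n → k) :
    diagElt Q a (f * g) = diagElt Q a f * diagElt Q a g := by
  simp [diagElt, sum_mul_sum, charIdem_mul_charIdem hQ ha, smul_smul, mul_comm]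

theorem diagElt_character (hQ : IsPrimitiveRoot Q n) {a : R} (ha : a ^ n = 1) :
    diagElt Q a (fun s : ZMod n => Q ^ s.val) = a := by
  calc diagElt Q a (fun s : ZMod n => Q ^ s.val) = a * diagElt Q a (1 : ZMod n → k) := by
        simp [diagElt, mul_sum, mul_charIdem hQ ha]
    _ = a := by rw [diagElt_one hQ, mul_one]

omit [CharZero k] in
theorem mul_charIdem_of_skew (hQ : IsPrimitiveRoot Q n) {a b : R} (hb : b * a = Q • (a * b))
    (s : ZMod n) : b * charIdem Q a (s + 1) = charIdem Q a s * b := by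
  have hQ0 : Q ≠ 0 := hQ.ne_zero (NeZero.ne n)
  have hpow : ∀ j, b * a ^ j = Q ^ j • (a ^ j * b) := by
    intro j
    induction j with
    | zero => simp
    | succ j ih =>
      rw [pow_succ, ← mul_assoc, ih, smul_mul_assoc, mul_assoc, hb, mul_smul_comm, smul_smul,
        ← mul_assoc, ← pow_succ]
  rw [charIdem, charIdem, mul_smul_comm, smul_mul_assoc, mul_sum, sum_mul]
  congr 1
  refine sum_congr rfl fun j _ => ?_
  rw [mul_smul_comm, hpow, smul_mul_assoc, smul_smul, pow_mul, pow_val_add_one hQ.pow_eq_one,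
    mul_pow, mul_inv, mul_comm, ← mul_assoc, mul_inv_cancel₀ (pow_ne_zero _ hQ0), one_mul, pow_mul]

omit [CharZero k] in
theorem mul_diagElt_of_skew (hQ : IsPrimitiveRoot Q n) {a b : R} (hb : b * a = Q • (a * b))
    (f : ZMod n → k) : b * diagElt Q a f = diagElt Q a (fun s => f (s + 1)) * b := by
  rw [diagElt, diagElt, mul_sum, sum_mul, ← Equiv.sum_comp (Equiv.addRight (1 : ZMod n))]
  simp [mul_charIdem_of_skew hQ hb]

theorem diagElt_mul_pow (hQ : IsPrimitiveRoot Q n) {a b : R} (ha : a ^ n = 1)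
    (hb : b * a = Q • (a * b)) (f : ZMod n → k) (m : ℕ) :
    (diagElt Q a f * b) ^ m = diagElt Q a (fun s : ZMod n => ∏ j ∈ range m, f (s + j)) * b ^ m := by
  induction m with
  | zero =>
    simp only [pow_zero, prod_range_zero, mul_one]
    exact (diagElt_one hQ a).symm
  | succ m ih =>
    rw [pow_succ', ih, mul_assoc, ← mul_assoc b, mul_diagElt_of_skew hQ hb, mul_assoc, ← pow_succ',
      ← mul_assoc, ← diagElt_mul hQ ha]
    congr 2
    funext s
    rw [prod_range_succ', Pi.mul_apply, mul_comm]
    simp only [Nat.cast_zero, add_zero, Nat.cast_succ]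
    congr 1
    exact prod_congr rfl fun j _ => by rw [add_assoc, add_comm 1]

theorem diagElt_mul_pow_card (hQ : IsPrimitiveRoot Q n) {a b : R} (ha : a ^ n = 1)
    (hb : b * a = Q • (a * b)) (hbn : b ^ n = 1) (f : ZMod n → k) :
    (diagElt Q a f * b) ^ n = algebraMap k R (∏ s, f s) := by
  have h : (fun s => ∏ j ∈ range n, f (s + j)) = (∏ s, f s) • (1 : ZMod n → k) := by
    funext s
    simp [prod_range_add_natCast]
  rw [diagElt_mul_pow hQ ha hb, h, diagElt_smul, diagElt_one hQ, hbn, mul_one,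
    Algebra.algebraMap_eq_smul_one]

/-- The diagonal function taking the value `Q` at `0` and `1` elsewhere. -/
def twist (n : ℕ) (Q : k) (s : ZMod n) : k := if s = 0 then Q else 1

omit [CharZero k] in
theorem map_EF (F : FreeAlgebra k (Fin 3) →ₐ[k] R) (r : ZMod n) :
    F (EF k n Q r) = diagElt Q (F (FreeAlgebra.ι k 0)) (fun s => twist n Q (s + 1 + r)) := by
  have h1 : ∀ s, F (oneF k n Q s) = charIdem Q (F (FreeAlgebra.ι k 0)) s :=
    map_charIdem F (FreeAlgebra.ι k 0)
  rw [diagElt, ← Equiv.sum_comp (Equiv.subRight r), sum_zmod_eq_sum_range]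
  obtain ⟨m, rfl⟩ := Nat.exists_eq_succ_of_ne_zero (NeZero.ne n)
  rw [sum_range_succ]
  simp only [EF, map_add, map_sum, map_smul, h1, Nat.succ_eq_add_one, Nat.add_sub_cancel]
  congr 1
  · refine sum_congr rfl fun j hj => ?_
    have hj0 : (j : ZMod (m + 1)) + 1 ≠ 0 := by
      rw [← Nat.cast_succ, Ne, ZMod.natCast_eq_zero_iff]
      exact Nat.not_dvd_of_pos_of_lt j.succ_pos (by simpa using hj)
    have hj1 : (j : ZMod (m + 1)) - r + 1 + r = j + 1 := by ring
    simp [twist, hj1, hj0]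
  · have hm0 : (m : ZMod (m + 1)) + 1 = 0 := by
      rw [← Nat.cast_succ]
      exact ZMod.natCast_self _
    have hm1 : (m : ZMod (m + 1)) - r + 1 + r = m + 1 := by ring
    have hm2 : ((m + 1 : ℕ) : ZMod (m + 1)) - 1 - r = m - r := by
      push_cast
      ring
    rw [Equiv.subRight_apply, hm1, hm0, hm2]
    simp [twist]

end Diagonal

section Triple

variable {k : Type*} [Field k] {n : ℕ} [NeZero n] {Q : k} {R : Type*} [Ring R] [Algebra k R]

/-- Elements of an algebra satisfying the defining relations of `B(Q)`. -/
structure IsBTriple (n : ℕ) [NeZero n] (Q : k) (a x y : R) : Prop where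
  a_pow : a ^ n = 1
  x_pow : x ^ n = 1
  y_pow : y ^ n = 1
  x_mul_a : x * a = Q • (a * x)
  y_mul_a : y * a = Q • (a * y)
  x_mul_y : diagElt Q a (fun s => twist n Q (s + 1)) * (x * y) =
    diagElt Q a (twist n Q) * (y * x)

omit [NeZero n] in
theorem twist_ne_zero (hQ : Q ≠ 0) (s : ZMod n) : twist n Q s ≠ 0 := by
  unfold twist
  split_ifs
  exacts [hQ, one_ne_zero]

theorem prod_twist : ∏ s, twist n Q s = Q := by
  simp [twist]

/-- The central element `w` with `x = g(a) w y`. -/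
noncomputable def centralElt (n : ℕ) [NeZero n] (Q : k) (a x y : R) : R :=
  diagElt Q a (twist n Q)⁻¹ * (x * y ^ (n - 1))

/-- The span of the monomials `𝟏ₛ yⁱ wʲ`. -/
noncomputable def monomialSpan (n : ℕ) [NeZero n] (Q : k) (a x y : R) : Submodule k R :=
  Submodule.span k (Set.range fun p : ZMod n × Fin n × Fin n =>
    charIdem Q a p.1 * y ^ (p.2.1 : ℕ) * centralElt n Q a x y ^ (p.2.2 : ℕ))

namespace IsBTriple

variable {a x y : R}

theorem y_pow_pred_mul (h : IsBTriple n Q a x y) : y ^ (n - 1) * y = 1 := by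
  rw [← pow_succ, Nat.sub_add_cancel (NeZero.one_le), h.y_pow]

theorem y_mul_pow_pred (h : IsBTriple n Q a x y) : y * y ^ (n - 1) = 1 := by
  rw [← pow_succ', Nat.sub_add_cancel (NeZero.one_le), h.y_pow]

theorem commute_diagElt {w : R} (hw : Commute w a) (f : ZMod n → k) :
    Commute w (diagElt Q a f) :=
  Commute.sum_right _ _ _ fun _ _ => Commute.smul_right
    (Commute.smul_right (Commute.sum_right _ _ _ fun j _ =>
      Commute.smul_right (Commute.pow_right hw j) _) _) _

theorem commute_centralElt_a (hQ : IsPrimitiveRoot Q n) (h : IsBTriple n Q a x y) :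
    Commute (centralElt n Q a x y) a := by
  have hy : ∀ m, y ^ m * a = Q ^ m • (a * y ^ m) := by
    intro m
    induction m with
    | zero => simp
    | succ m ih =>
      rw [pow_succ, mul_assoc, h.y_mul_a, mul_smul_comm, ← mul_assoc, ih, smul_mul_assoc,
        smul_smul, mul_assoc, ← pow_succ']
  refine Commute.mul_left (commute_diagElt (Commute.refl a) _).symm ?_
  rw [commute_iff_eq, mul_assoc, hy, mul_smul_comm, ← mul_assoc, h.x_mul_a, smul_mul_assoc,
    smul_smul, ← pow_succ, Nat.sub_add_cancel (NeZero.one_le), hQ.pow_eq_one, one_smul, mul_assoc]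

variable [CharZero k]

theorem x_eq (hQ : IsPrimitiveRoot Q n) (h : IsBTriple n Q a x y) :
    x = diagElt Q a (twist n Q) * (centralElt n Q a x y * y) := by
  have hg : twist n Q * (twist n Q)⁻¹ = 1 := by
    funext s
    exact mul_inv_cancel₀ (twist_ne_zero (hQ.ne_zero (NeZero.ne n)) s)
  rw [centralElt, mul_assoc, mul_assoc x, h.y_pow_pred_mul, mul_one, ← mul_assoc,
    ← diagElt_mul hQ h.a_pow, hg, diagElt_one hQ, one_mul]

theorem commute_centralElt_y (hQ : IsPrimitiveRoot Q n) (h : IsBTriple n Q a x y) :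
    Commute (centralElt n Q a x y) y := by
  have hQ0 := hQ.ne_zero (NeZero.ne n)
  set Sg : ZMod n → k := fun s => twist n Q (s + 1) with hSg
  have hg : (twist n Q)⁻¹ * twist n Q = 1 := by
    funext s
    exact inv_mul_cancel₀ (twist_ne_zero hQ0 s)
  have hs : Sg⁻¹ * Sg = 1 := by
    funext s
    exact inv_mul_cancel₀ (twist_ne_zero hQ0 (s + 1))
  have hyx : y * x = diagElt Q a ((twist n Q)⁻¹ * Sg) * (x * y) := by
    rw [diagElt_mul hQ h.a_pow, mul_assoc, h.x_mul_y, ← mul_assoc, ← diagElt_mul hQ h.a_pow, hg,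
      diagElt_one hQ, one_mul]
  have hfun : Sg⁻¹ * ((twist n Q)⁻¹ * Sg) = (twist n Q)⁻¹ := by
    rw [mul_left_comm, hs, mul_one]
  calc centralElt n Q a x y * y = diagElt Q a (twist n Q)⁻¹ * x := by
        rw [centralElt, mul_assoc, mul_assoc, h.y_pow_pred_mul, mul_one]
    _ = diagElt Q a Sg⁻¹ * (y * x) * y ^ (n - 1) := by
        rw [hyx, ← mul_assoc (diagElt Q a Sg⁻¹), ← diagElt_mul hQ h.a_pow, hfun, mul_assoc,
          mul_assoc x, h.y_mul_pow_pred, mul_one]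
    _ = y * centralElt n Q a x y := by
        rw [centralElt, ← mul_assoc y, mul_diagElt_of_skew hQ h.y_mul_a]
        simp only [mul_assoc]
        rfl

theorem centralElt_pow (hQ : IsPrimitiveRoot Q n) (h : IsBTriple n Q a x y) :
    centralElt n Q a x y ^ n = algebraMap k R Q⁻¹ := by
  have hQ0 := hQ.ne_zero (NeZero.ne n)
  have hc : Commute (centralElt n Q a x y) (diagElt Q a (twist n Q) * y) :=
    (commute_diagElt (h.commute_centralElt_a hQ) _).mul_right (h.commute_centralElt_y hQ)
  have hx : x = centralElt n Q a x y * (diagElt Q a (twist n Q) * y) := by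
    rw [hc.eq, mul_assoc, ← (h.commute_centralElt_y hQ).eq]
    exact h.x_eq hQ
  have h1 : centralElt n Q a x y ^ n * algebraMap k R Q = 1 := by
    rw [← h.x_pow, ← prod_twist (n := n) (Q := Q),
      ← diagElt_mul_pow_card hQ h.a_pow h.y_mul_a h.y_pow, prod_twist, ← hc.mul_pow, ← hx]
  calc centralElt n Q a x y ^ n
      = centralElt n Q a x y ^ n * algebraMap k R Q * algebraMap k R Q⁻¹ := by
        rw [mul_assoc, ← map_mul, mul_inv_cancel₀ hQ0, map_one, mul_one]
    _ = algebraMap k R Q⁻¹ := by rw [h1, one_mul]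

theorem diagElt_mul_mem_monomialSpan (hQ : IsPrimitiveRoot Q n) (h : IsBTriple n Q a x y)
    (f : ZMod n → k) (i j : ℕ) :
    diagElt Q a f * y ^ i * centralElt n Q a x y ^ j ∈ monomialSpan n Q a x y := by
  have hn : 0 < n := NeZero.pos n
  have hwj : centralElt n Q a x y ^ j =
      (Q⁻¹ ^ (j / n)) • centralElt n Q a x y ^ (j % n) := by
    conv_lhs => rw [← Nat.div_add_mod j n, pow_add, pow_mul, h.centralElt_pow hQ, ← map_pow]
    rw [← Algebra.smul_def]
  rw [pow_eq_pow_mod i h.y_pow, hwj, mul_smul_comm, diagElt, sum_mul, sum_mul]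
  refine Submodule.smul_mem _ _ (Submodule.sum_mem _ fun s _ => ?_)
  rw [smul_mul_assoc, smul_mul_assoc]
  exact Submodule.smul_mem _ _ (Submodule.subset_span
    ⟨(s, ⟨i % n, Nat.mod_lt i hn⟩, ⟨j % n, Nat.mod_lt j hn⟩), rfl⟩)

theorem one_mem_monomialSpan (hQ : IsPrimitiveRoot Q n) (h : IsBTriple n Q a x y) :
    1 ∈ monomialSpan n Q a x y := by
  simpa [diagElt_one hQ] using h.diagElt_mul_mem_monomialSpan hQ 1 0 0

theorem mul_mem_monomialSpan (hQ : IsPrimitiveRoot Q n) (h : IsBTriple n Q a x y) {z : R}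
    (hz : z ∈ monomialSpan n Q a x y) :
    a * z ∈ monomialSpan n Q a x y ∧ x * z ∈ monomialSpan n Q a x y ∧
      y * z ∈ monomialSpan n Q a x y := by
  have hmem := h.diagElt_mul_mem_monomialSpan hQ
  set S := monomialSpan n Q a x y with hS
  set w := centralElt n Q a x y with hw
  have hwy : Commute w y := h.commute_centralElt_y hQ
  have hwa : Commute w a := h.commute_centralElt_a hQ
  have ha : ∀ f : ZMod n → k, a * diagElt Q a f =
      diagElt Q a ((fun s : ZMod n => Q ^ s.val) * f) := fun f => by
    rw [diagElt_mul hQ h.a_pow, diagElt_character hQ h.a_pow]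
  have hy : ∀ f : ZMod n → k, y * diagElt Q a f = diagElt Q a (fun s => f (s + 1)) * y :=
    mul_diagElt_of_skew hQ h.y_mul_a
  have hgen : ∀ (f : ZMod n → k) (i j : ℕ), a * (diagElt Q a f * y ^ i * w ^ j) ∈ S ∧
      x * (diagElt Q a f * y ^ i * w ^ j) ∈ S ∧ y * (diagElt Q a f * y ^ i * w ^ j) ∈ S := by
    intro f i j
    refine ⟨?_, ?_, ?_⟩
    · rw [← mul_assoc, ← mul_assoc, ha]
      exact hmem _ _ _
    · have hx : x * (diagElt Q a f * y ^ i * w ^ j) =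
          diagElt Q a (twist n Q * fun s => f (s + 1)) * y ^ (i + 1) * w ^ (j + 1) := by
        calc x * (diagElt Q a f * y ^ i * w ^ j)
            = diagElt Q a (twist n Q) * (w * (y * diagElt Q a f * y ^ i * w ^ j)) := by
              conv_lhs => rw [h.x_eq hQ]
              simp only [mul_assoc, ← hw]
          _ = _ := by
              rw [hy, diagElt_mul hQ h.a_pow]
              have hc : Commute w (diagElt Q a (fun s => f (s + 1)) * y * y ^ i * w ^ j) :=
                (((commute_diagElt hwa _).mul_right hwy).mul_right (hwy.pow_right i)).mul_right
                  ((Commute.refl w).pow_right j)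
              rw [hc.eq, pow_succ', pow_succ w]
              simp only [mul_assoc]
      rw [hx]
      exact hmem _ _ _
    · rw [← mul_assoc, ← mul_assoc, hy, mul_assoc _ y, ← pow_succ']
      exact hmem _ _ _
  induction hz using Submodule.span_induction with
  | mem z hz =>
    obtain ⟨p, rfl⟩ := hz
    simpa only [diagElt_single] using hgen (Pi.single p.1 1) p.2.1 p.2.2
  | zero => simp
  | add u v _ _ hu hv =>
    simp only [mul_add]
    exact ⟨S.add_mem hu.1 hv.1, S.add_mem hu.2.1 hv.2.1, S.add_mem hu.2.2 hv.2.2⟩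
  | smul c u _ hu =>
    simp only [mul_smul_comm]
    exact ⟨S.smul_mem c hu.1, S.smul_mem c hu.2.1, S.smul_mem c hu.2.2⟩

end IsBTriple

end Triple

section Presentation

variable {k : Type*} [Field k] {n : ℕ} {Q : k}

/-- The quotient map from the free algebra onto `B(Q)`. -/
noncomputable def BAlgebra.mk (k : Type*) [Field k] (n : ℕ) (Q : k) :
    FreeAlgebra k (Fin 3) →ₐ[k] BAlgebra k n Q :=
  RingQuot.mkAlgHom k (BRel k n Q)

theorem BAlgebra.mk_surjective : Function.Surjective (BAlgebra.mk k n Q) :=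
  RingQuot.mkAlgHom_surjective k (BRel k n Q)

theorem BAlgebra.mk_eq_of_rel {u v : FreeAlgebra k (Fin 3)} (h : BRel k n Q u v) :
    BAlgebra.mk k n Q u = BAlgebra.mk k n Q v :=
  RingQuot.mkAlgHom_rel k h

theorem isBTriple_generators [NeZero n] :
    IsBTriple n Q (Ba k n Q) (Bxi k n Q) (Beta k n Q) := by
  have h0 : BAlgebra.mk k n Q (FreeAlgebra.ι k 0) = Ba k n Q := rfl
  have h1 : BAlgebra.mk k n Q (FreeAlgebra.ι k 1) = Bxi k n Q := rfl
  have h2 : BAlgebra.mk k n Q (FreeAlgebra.ι k 2) = Beta k n Q := rfl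
  constructor
  · simpa only [map_pow, map_one, h0] using BAlgebra.mk_eq_of_rel (BRel.apow (n := n) (Q := Q))
  · simpa only [map_pow, map_one, h1] using BAlgebra.mk_eq_of_rel (BRel.xipow (n := n) (Q := Q))
  · simpa only [map_pow, map_one, h2] using BAlgebra.mk_eq_of_rel (BRel.etapow (n := n) (Q := Q))
  · simpa only [map_mul, map_smul, h0, h1] using
      BAlgebra.mk_eq_of_rel (BRel.xia (n := n) (Q := Q))
  · simpa only [map_mul, map_smul, h0, h2] using
      BAlgebra.mk_eq_of_rel (BRel.etaa (n := n) (Q := Q))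
  · simpa only [map_mul, map_EF, h0, h1, h2, add_zero, add_neg_cancel_right] using
      BAlgebra.mk_eq_of_rel (BRel.xieta (n := n) (Q := Q))

variable [NeZero n]

theorem IsBTriple.exists_algHom {R : Type*} [Ring R] [Algebra k R] {a x y : R}
    (h : IsBTriple n Q a x y) : ∃ F : BAlgebra k n Q →ₐ[k] R,
      F (Ba k n Q) = a ∧ F (Bxi k n Q) = x ∧ F (Beta k n Q) = y := by
  set G : FreeAlgebra k (Fin 3) →ₐ[k] R := FreeAlgebra.lift k ![a, x, y] with hG
  have h0 : G (FreeAlgebra.ι k 0) = a := by simp [hG]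
  have h1 : G (FreeAlgebra.ι k 1) = x := by simp [hG]
  have h2 : G (FreeAlgebra.ι k 2) = y := by simp [hG]
  have hrel : ∀ ⦃u v⦄, BRel k n Q u v → G u = G v := by
    intro u v huv
    cases huv with
    | apow => simpa only [map_pow, map_one, h0] using h.a_pow
    | xipow => simpa only [map_pow, map_one, h1] using h.x_pow
    | etapow => simpa only [map_pow, map_one, h2] using h.y_pow
    | xia => simpa only [map_mul, map_smul, h0, h1] using h.x_mul_a
    | etaa => simpa only [map_mul, map_smul, h0, h2] using h.y_mul_a
    | xieta =>
      simpa only [map_mul, map_EF, h0, h1, h2, add_zero, add_neg_cancel_right] using h.x_mul_y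
  refine ⟨RingQuot.liftAlgHom k ⟨G, hrel⟩, ?_, ?_, ?_⟩
  · exact (RingQuot.liftAlgHom_mkAlgHom_apply k G hrel _).trans h0
  · exact (RingQuot.liftAlgHom_mkAlgHom_apply k G hrel _).trans h1
  · exact (RingQuot.liftAlgHom_mkAlgHom_apply k G hrel _).trans h2

variable [CharZero k]

theorem monomialSpan_eq_top (hQ : IsPrimitiveRoot Q n) :
    monomialSpan n Q (Ba k n Q) (Bxi k n Q) (Beta k n Q) = ⊤ := by
  set S := monomialSpan n Q (Ba k n Q) (Bxi k n Q) (Beta k n Q)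
  have h := isBTriple_generators (n := n) (Q := Q)
  have hact : ∀ u : FreeAlgebra k (Fin 3), ∀ z ∈ S, BAlgebra.mk k n Q u * z ∈ S := by
    intro u
    induction u using FreeAlgebra.induction with
    | grade0 c =>
      intro z hz
      rw [AlgHom.commutes, ← Algebra.smul_def]
      exact S.smul_mem c hz
    | grade1 i =>
      intro z hz
      have hz' := h.mul_mem_monomialSpan hQ hz
      fin_cases i
      exacts [hz'.1, hz'.2.1, hz'.2.2]
    | mul u v hu hv =>
      intro z hz
      rw [map_mul, mul_assoc]
      exact hu _ (hv z hz)
    | add u v hu hv =>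
      intro z hz
      rw [map_add, add_mul]
      exact S.add_mem (hu z hz) (hv z hz)
  rw [eq_top_iff]
  intro z _
  obtain ⟨u, rfl⟩ := BAlgebra.mk_surjective z
  simpa using hact u 1 (h.one_mem_monomialSpan hQ)

theorem BAlgebra.finite (hQ : IsPrimitiveRoot Q n) : Module.Finite k (BAlgebra k n Q) :=
  ⟨monomialSpan_eq_top hQ ▸ Submodule.fg_span (Set.finite_range _)⟩

theorem BAlgebra.finrank_le (hQ : IsPrimitiveRoot Q n) :
    Module.finrank k (BAlgebra k n Q) ≤ n ^ 3 := by
  rw [← finrank_top k (BAlgebra k n Q), ← monomialSpan_eq_top hQ]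
  refine (finrank_range_le_card _).trans_eq ?_
  simp [ZMod.card, pow_succ, mul_assoc]

end Presentation

section Representation

variable {k : Type*} [Field k] {n : ℕ} {Q : k}

/-- The matrix of the cyclic shift `v_t ↦ v_{t-1}`. -/
def shiftMatrix (k : Type*) [Field k] (n : ℕ) : Matrix (ZMod n) (ZMod n) k :=
  Matrix.of fun s t => if s + 1 = t then 1 else 0

variable [NeZero n]

theorem shiftMatrix_mul_diagonal (f : ZMod n → k) :
    shiftMatrix k n * Matrix.diagonal f =
      Matrix.diagonal (fun s => f (s + 1)) * shiftMatrix k n := by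
  ext s t
  rw [Matrix.mul_diagonal, Matrix.diagonal_mul, shiftMatrix, Matrix.of_apply]
  split_ifs with h
  · simp [h]
  · simp

theorem shiftMatrix_pow (j : ℕ) :
    shiftMatrix k n ^ j = Matrix.of fun s t : ZMod n => if s + j = t then 1 else 0 := by
  induction j with
  | zero =>
    ext s t
    simp [Matrix.one_apply]
  | succ j ih =>
    ext s t
    rw [pow_succ, ih, Matrix.mul_apply]
    simp only [Matrix.of_apply, shiftMatrix, ite_mul, one_mul, zero_mul, sum_ite_eq, mem_univ, if_true,
      Nat.cast_succ, add_assoc]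

theorem shiftMatrix_pow_card : shiftMatrix k n ^ n = 1 := by
  rw [shiftMatrix_pow]
  ext s t
  simp [Matrix.one_apply]

/-- The diagonal matrix by which `a` acts. -/
def characterMatrix (n : ℕ) (Q : k) : Matrix (ZMod n) (ZMod n) k :=
  Matrix.diagonal fun s => Q ^ s.val

variable [CharZero k]

theorem charIdem_character (hQ : IsPrimitiveRoot Q n) (s : ZMod n) :
    charIdem Q (fun t : ZMod n => Q ^ t.val) s = Pi.single s 1 := by
  funext t
  have h := sum_range_character hQ t s
  simp only [pow_mul] at h
  simp [charIdem, Finset.sum_apply, Pi.single_apply, pow_mul, h]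

theorem diagElt_characterMatrix (hQ : IsPrimitiveRoot Q n) (f : ZMod n → k) :
    diagElt Q (characterMatrix n Q) f = Matrix.diagonal f := by
  have h := map_diagElt (Q := Q) (Matrix.diagonalAlgHom (n := ZMod n) (α := k) k)
    (fun t : ZMod n => Q ^ t.val) f
  have hf : diagElt Q (fun t : ZMod n => Q ^ t.val) f = f := by
    funext t
    simp [diagElt, charIdem_character hQ, Finset.sum_apply, Pi.single_apply]
  rw [hf] at h
  exact h.symm

/-- The matrix by which `ξ` acts on the module with parameter `q`. -/
def xiMatrix (n : ℕ) [NeZero n] (Q q : k) : Matrix (ZMod n) (ZMod n) k :=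
  Matrix.diagonal (q⁻¹ • twist n Q) * shiftMatrix k n

theorem isBTriple_matrix (hQ : IsPrimitiveRoot Q n) {q : k} (hq : q ^ n = Q) :
    IsBTriple n Q (characterMatrix n Q) (xiMatrix n Q q) (shiftMatrix k n) := by
  have hQ0 := hQ.ne_zero (NeZero.ne n)
  have ha : characterMatrix n Q ^ n = 1 := by
    rw [characterMatrix, Matrix.diagonal_pow, ← Matrix.diagonal_one]
    congr 1
    funext s
    rw [Pi.pow_apply, ← pow_mul', pow_mul, hQ.pow_eq_one, one_pow]
  have hy : shiftMatrix k n * characterMatrix n Q =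
      Q • (characterMatrix n Q * shiftMatrix k n) := by
    rw [characterMatrix, shiftMatrix_mul_diagonal, ← smul_mul_assoc, ← Matrix.diagonal_smul]
    congr 2
    funext s
    exact pow_val_add_one hQ.pow_eq_one s
  refine ⟨ha, ?_, shiftMatrix_pow_card, ?_, hy, ?_⟩
  · rw [xiMatrix, ← diagElt_characterMatrix hQ,
      diagElt_mul_pow_card hQ ha hy shiftMatrix_pow_card]
    simp [prod_mul_distrib, prod_twist, hq, hQ0]
  · rw [xiMatrix, mul_assoc, hy, mul_smul_comm, ← mul_assoc, ← mul_assoc, characterMatrix,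
      Matrix.diagonal_mul_diagonal, Matrix.diagonal_mul_diagonal]
    simp only [mul_comm]
  · rw [diagElt_characterMatrix hQ, diagElt_characterMatrix hQ, xiMatrix, ← mul_assoc (shiftMatrix k n),
      shiftMatrix_mul_diagonal]
    simp only [← mul_assoc, Matrix.diagonal_mul_diagonal]
    congr 3
    funext s
    simp only [Pi.smul_apply, smul_eq_mul]
    ring

theorem centralElt_matrix (hQ : IsPrimitiveRoot Q n) (q : k) :
    centralElt n Q (characterMatrix n Q) (xiMatrix n Q q) (shiftMatrix k n) =
      algebraMap k _ q⁻¹ := by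
  have hQ0 := hQ.ne_zero (NeZero.ne n)
  rw [centralElt, xiMatrix, diagElt_characterMatrix hQ, mul_assoc, ← pow_succ',
    Nat.sub_add_cancel NeZero.one_le, shiftMatrix_pow_card, mul_one, Matrix.diagonal_mul_diagonal,
    Matrix.algebraMap_eq_diagonal]
  congr 1
  funext s
  simp [mul_left_comm, inv_mul_cancel₀ (twist_ne_zero hQ0 s)]

theorem charIdem_mul_shiftMatrix_pow (hQ : IsPrimitiveRoot Q n) (s t : ZMod n) :
    charIdem Q (characterMatrix n Q) s * shiftMatrix k n ^ (t - s).val = Matrix.single s t 1 := by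
  rw [← diagElt_single, diagElt_characterMatrix hQ, shiftMatrix_pow]
  ext i j
  rw [Matrix.diagonal_mul, Matrix.of_apply, ZMod.natCast_zmod_val, Matrix.single_apply,
    Pi.single_apply]
  by_cases hi : i = s
  · subst hi
    simp
  · simp [hi, Ne.symm hi]

end Representation

section Wedderburn

variable {k : Type*} [Field k] {n : ℕ} {Q : k} [NeZero n]

theorem card_roots [IsAlgClosed k] (hQ : IsPrimitiveRoot Q n) :
    Nat.card {q : k // q ^ n = Q} = n := by
  classical
  have hn : 0 < n := NeZero.pos n
  have hset : {q : k | q ^ n = Q} = (Polynomial.nthRootsFinset n Q : Set k) := by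
    ext q
    simp [Polynomial.mem_nthRootsFinset hn]
  have hex : ∃ q : k, q ^ n = Q := IsAlgClosed.exists_pow_nat_eq Q hn
  have h1 : Nat.card {q : k // q ^ n = Q} = (Polynomial.nthRootsFinset n Q).card := by
    rw [← Set.ncard_coe_finset, ← hset]
    rfl
  rw [h1, Polynomial.nthRootsFinset_def,
    Multiset.toFinset_card_of_nodup (hQ.nthRoots_nodup (hQ.ne_zero (NeZero.ne n))),
    hQ.card_nthRoots, if_pos hex]

theorem bijective_of_surjective_of_finrank_le {k A B : Type*} [Field k] [Ring A] [Algebra k A]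
    [Ring B] [Algebra k B] [Module.Finite k A] (F : A →ₐ[k] B) (hF : Function.Surjective F)
    (hle : Module.finrank k A ≤ Module.finrank k B) : Function.Bijective F := by
  have : FiniteDimensional k B := Module.Finite.of_surjective F.toLinearMap hF
  have heq := le_antisymm hle
    (LinearMap.finrank_le_finrank_of_surjective (f := F.toLinearMap) hF)
  exact ⟨(LinearMap.injective_iff_surjective_of_finrank_eq_finrank (f := F.toLinearMap) heq).2 hF,
    hF⟩

/-- Matrices over the cyclic group act on `Fin n → k`. -/
noncomputable def matrixZModEquivEnd (k : Type*) [Field k] (n : ℕ) [NeZero n] :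
    Matrix (ZMod n) (ZMod n) k ≃ₐ[k] Module.End k (Fin n → k) :=
  (Matrix.reindexAlgEquiv k k (ZMod.finEquiv n).symm.toEquiv).trans Matrix.toLinAlgEquiv'

variable [CharZero k]

theorem exists_surjective_algHom (hQ : IsPrimitiveRoot Q n) [Finite {q : k // q ^ n = Q}] :
    ∃ F : BAlgebra k n Q →ₐ[k] ({q : k // q ^ n = Q} → Matrix (ZMod n) (ZMod n) k),
      Function.Surjective F := by
  classical
  have := Fintype.ofFinite {q : k // q ^ n = Q}
  choose F hFa hFx hFy using
    fun q : {q : k // q ^ n = Q} => (isBTriple_matrix hQ q.2).exists_algHom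
  refine ⟨AlgHom.pi F, ?_⟩
  set w := centralElt n Q (Ba k n Q) (Bxi k n Q) (Beta k n Q) with hw
  have hFw : ∀ q, F q w = algebraMap k _ (q : k)⁻¹ := by
    intro q
    rw [← centralElt_matrix hQ, hw, centralElt, map_mul, map_mul, map_pow, map_diagElt, hFa, hFx,
      hFy, centralElt]
  have hinj : Function.Injective fun q : {q : k // q ^ n = Q} => (q : k)⁻¹ :=
    inv_injective.comp Subtype.val_injective
  have hsingle : ∀ (q : {q : k // q ^ n = Q}) (s t : ZMod n) (c : k),
      Pi.single q (Matrix.single s t c) ∈ (AlgHom.pi F).range := by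
    intro q s t c
    refine ⟨c • (charIdem Q (Ba k n Q) s * Beta k n Q ^ (t - s).val *
      Polynomial.aeval w (Lagrange.basis univ (fun q : {q : k // q ^ n = Q} => (q : k)⁻¹) q)), ?_⟩
    funext q'
    have hl : F q' (Polynomial.aeval w
        (Lagrange.basis univ (fun q : {q : k // q ^ n = Q} => (q : k)⁻¹) q)) =
        if q' = q then 1 else 0 := by
      rw [← Polynomial.aeval_algHom_apply, hFw, Polynomial.aeval_algebraMap_apply,
        Polynomial.coe_aeval_eq_eval]
      split_ifs with h
      · rw [h, Lagrange.eval_basis_self hinj.injOn (mem_univ q), map_one]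
      · rw [Lagrange.eval_basis_of_ne (v := fun q : {q : k // q ^ n = Q} => (q : k)⁻¹)
          (Ne.symm h) (mem_univ q'), map_zero]
    have hm : F q' (charIdem Q (Ba k n Q) s * Beta k n Q ^ (t - s).val) = Matrix.single s t 1 := by
      rw [map_mul, map_pow, map_charIdem, hFa, hFy, charIdem_mul_shiftMatrix_pow hQ]
    change F q' _ = _
    rw [map_smul, map_mul, hm, hl, Pi.single_apply]
    split_ifs
    · rw [mul_one, Matrix.smul_single, smul_eq_mul, mul_one]
    · rw [mul_zero, smul_zero]
  intro M
  change M ∈ (AlgHom.pi F).range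
  rw [← Finset.univ_sum_single M]
  refine Subalgebra.sum_mem _ fun q _ => ?_
  rw [Matrix.matrix_eq_sum_single (M q), ← LinearMap.single_apply (R := k), map_sum]
  refine Subalgebra.sum_mem _ fun s _ => ?_
  rw [map_sum]
  exact Subalgebra.sum_mem _ fun t _ => hsingle q s t _

omit [CharZero k] in
theorem finrank_pi_matrix [IsAlgClosed k] (hQ : IsPrimitiveRoot Q n)
    [Finite {q : k // q ^ n = Q}] :
    Module.finrank k ({q : k // q ^ n = Q} → Matrix (ZMod n) (ZMod n) k) = n ^ 3 := by
  have := Fintype.ofFinite {q : k // q ^ n = Q}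
  rw [Module.finrank_pi_fintype]
  simp only [Module.finrank_matrix, ZMod.card, Module.finrank_self, mul_one, sum_const, card_univ,
    smul_eq_mul, Fintype.card_eq_nat_card (α := {q : k // q ^ n = Q}), card_roots hQ]
  ring

theorem nonempty_algEquiv_matrix [IsAlgClosed k] (hQ : IsPrimitiveRoot Q n) :
    Nonempty (BAlgebra k n Q ≃ₐ[k]
      ({q : k // q ^ n = Q} → Matrix (ZMod n) (ZMod n) k)) := by
  have hfin : Finite {q : k // q ^ n = Q} :=
    Nat.finite_of_card_ne_zero (by rw [card_roots hQ]; exact NeZero.ne n)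
  have := BAlgebra.finite hQ
  obtain ⟨F, hF⟩ := exists_surjective_algHom hQ
  exact ⟨AlgEquiv.ofBijective F (bijective_of_surjective_of_finrank_le F hF
    (finrank_pi_matrix hQ ▸ BAlgebra.finrank_le hQ))⟩

end Wedderburn

/-- B(Q) ≅ ⊕_{q : qⁿ = Q} End_k(V_q): B(Q) is semisimple of dimension n³,
    with exactly n pairwise non-isomorphic irreducible modules, each of
    dimension n. -/
theorem B_wedderburn (n : ℕ) (hn : 2 ≤ n)
    (k : Type*) [Field k] [IsAlgClosed k] [CharZero k]
    (Q : k) (hQ : IsPrimitiveRoot Q n) :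
    Nonempty (BAlgebra k n Q ≃ₐ[k]
      ({q : k // q ^ n = Q} → Module.End k (Fin n → k))) ∧
    IsSemisimpleRing (BAlgebra k n Q) ∧
    Module.finrank k (BAlgebra k n Q) = n ^ 3 ∧
    Nat.card {q : k // q ^ n = Q} = n := by
  have : NeZero n := ⟨by omega⟩
  obtain ⟨e⟩ := nonempty_algEquiv_matrix hQ
  have : Finite {q : k // q ^ n = Q} :=
    Nat.finite_of_card_ne_zero (by rw [card_roots hQ]; exact NeZero.ne n)
  refine ⟨⟨e.trans (AlgEquiv.piCongrRight fun _ => matrixZModEquivEnd k n)⟩, ?_, ?_,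
    card_roots hQ⟩
  · exact e.symm.toRingEquiv.isSemisimpleRing
  · rw [e.toLinearEquiv.finrank_eq, finrank_pi_matrix hQ]
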